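/- Let X be a compact metric space and let r > 0. Then the Vietoris–Rips metric thickening VR^m(X;r) is strictly strongly locally contractible: for every μ ∈ VR^m(X;r) and every neighborhood U of μ in VR^m(X;r), there exist a neighborhood V of μ with V ⊆ U and a continuous map H : [0,1] × V → V such that H(0,ν) = ν for all ν ∈ V, H(1,ν) = μ for all ν ∈ V, and H(t,μ) = μ for all t ∈ [0,1]. -/

import Mathlib

open MeasureTheory Set

/-- The support of a probability measure: the set of points all of whose open
neighborhoods have positive measure. -/
def msupp {X : Type*} [TopologicalSpace X] [MeasurableSpace X]
    (μ : ProbabilityMeasure X) : Set X :=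
  {x | ∀ U : Set X, IsOpen U → x ∈ U → μ.toMeasure U ≠ 0}

/-- The Vietoris--Rips metric thickening `VRᵐ(X; r)`: all finitely supported Borel
probability measures whose support has diameter less than `r`. -/
def VRThickening (X : Type*) [MetricSpace X] [MeasurableSpace X] (r : ℝ) :
    Set (ProbabilityMeasure X) :=
  {μ | (msupp μ).Finite ∧ Metric.diam (msupp μ) < r}

open Filter Topology

section

lemma measureReal_le_normalize {X : Type*} [MeasurableSpace X] [Nonempty X]
    {m : FiniteMeasure X} (hm : (m : Measure X) univ ≤ 1) (A : Set X) :
    (m : Measure X).real A ≤ m.normalize.toMeasure.real A := by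
  have h : m.mass ≤ 1 := by
    rw [← ENNReal.coe_le_coe, FiniteMeasure.ennreal_mass]
    exact hm
  exact NNReal.coe_le_coe.2 ((m.self_eq_mass_mul_normalize A).trans_le (mul_le_of_le_one_left' h))

lemma normalize_null {X : Type*} [MeasurableSpace X] [Nonempty X]
    {m : FiniteMeasure X} (hm : m ≠ 0) {A : Set X} (hA : (m : Measure X) A = 0) :
    m.normalize.toMeasure A = 0 := by
  rw [FiniteMeasure.toMeasure_normalize_eq_of_nonzero m hm, Measure.smul_apply, hA, smul_zero]

variable {X : Type*} [MetricSpace X] [MeasurableSpace X]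

lemma msupp_eq_support (μ : ProbabilityMeasure X) : msupp μ = μ.toMeasure.support := by
  ext x
  simp only [msupp, mem_ofPred_eq, Measure.mem_support_iff_forall, pos_iff_ne_zero]
  constructor
  · intro h U hU
    obtain ⟨V, hVU, hV, hx⟩ := mem_nhds_iff.1 hU
    exact fun h0 => h V hV hx (measure_mono_null hVU h0)
  · exact fun h U hU hx => h U (hU.mem_nhds hx)

lemma msupp_subset_of_isClosed {μ : ProbabilityMeasure X} {C : Set X} (hC : IsClosed C)
    (h : μ.toMeasure Cᶜ = 0) : msupp μ ⊆ C :=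
  msupp_eq_support μ ▸ Measure.support_subset_of_isClosed hC h

/-- The set of measures that carry almost as much mass as `μ` near every atom of `μ`. -/
def atomNhd (μ : ProbabilityMeasure X) (η : ℝ) : Set (ProbabilityMeasure X) :=
  {ν | ∀ x ∈ msupp μ, μ.toMeasure.real {x} - η < ν.toMeasure.real (Metric.ball x η)}

lemma atomNhd_mono (μ : ProbabilityMeasure X) {η η' : ℝ} (h : η ≤ η') :
    atomNhd μ η ⊆ atomNhd μ η' := fun ν hν x hx =>
  calc μ.toMeasure.real {x} - η' ≤ μ.toMeasure.real {x} - η := by linarith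
    _ < ν.toMeasure.real (Metric.ball x η) := hν x hx
    _ ≤ ν.toMeasure.real (Metric.ball x η') := measureReal_mono (Metric.ball_subset_ball h)

lemma self_mem_atomNhd (μ : ProbabilityMeasure X) {η : ℝ} (hη : 0 < η) : μ ∈ atomNhd μ η :=
  fun x _ => by
    have : μ.toMeasure.real {x} ≤ μ.toMeasure.real (Metric.ball x η) :=
      measureReal_mono (singleton_subset_iff.2 (Metric.mem_ball_self hη))
    linarith

lemma eventually_lt_measureReal_of_isOpen [BorelSpace X] {μ : ProbabilityMeasure X} {G : Set X}
    (hG : IsOpen G) {a : ℝ} (ha : a < μ.toMeasure.real G) : ∀ᶠ ν in 𝓝 μ, a < ν.toMeasure.real G := by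
  rcases lt_or_ge a 0 with h0 | h0
  · exact .of_forall fun ν => h0.trans_le measureReal_nonneg
  have h := ProbabilityMeasure.le_liminf_measure_open_of_tendsto (tendsto_id (x := 𝓝 μ)) hG
  have ha' : ENNReal.ofReal a < μ.toMeasure G := (ENNReal.ofReal_lt_iff_lt_toReal h0 (by simp)).2 ha
  filter_upwards [eventually_lt_of_lt_liminf (ha'.trans_le h)] with ν hν
  exact (ENNReal.ofReal_lt_iff_lt_toReal h0 (by simp)).1 hν

lemma atomNhd_mem_nhds [BorelSpace X] {μ : ProbabilityMeasure X} (hμ : (msupp μ).Finite)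
    {η : ℝ} (hη : 0 < η) : atomNhd μ η ∈ 𝓝 μ :=
  (eventually_all_finite hμ).2 fun x hx =>
    eventually_lt_measureReal_of_isOpen Metric.isOpen_ball (self_mem_atomNhd μ hη x hx)

variable [CompactSpace X]

lemma measure_compl_msupp (μ : ProbabilityMeasure X) : μ.toMeasure (msupp μ)ᶜ = 0 :=
  msupp_eq_support μ ▸ Measure.measure_compl_support

lemma exists_measureReal_singleton_pos {μ : ProbabilityMeasure X} (hμ : (msupp μ).Finite) :
    ∃ x ∈ msupp μ, 0 < μ.toMeasure.real {x} := by
  by_contra! h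
  have h0 : μ.toMeasure (msupp μ) = 0 :=
    (measure_null_iff_singleton hμ.countable).2 fun x hx =>
      (measureReal_eq_zero_iff).1 (le_antisymm (h x hx) measureReal_nonneg)
  have h1 : μ.toMeasure univ = 0 := by
    rw [← union_compl_self (msupp μ)]
    exact measure_union_null h0 (measure_compl_msupp μ)
  simp at h1

variable [BorelSpace X]

lemma tendsto_of_mem_atomNhd {μ : ProbabilityMeasure X} (hμ : (msupp μ).Finite)
    {η : ℕ → ℝ} (hη : Tendsto η atTop (𝓝 0)) {ν : ℕ → ProbabilityMeasure X}
    (hν : ∀ n, ν n ∈ atomNhd μ (η n)) : Tendsto ν atTop (𝓝 μ) := by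
  refine tendsto_of_forall_isOpen_le_liminf' fun G hG => ?_
  have hfin : (G ∩ msupp μ).Finite := hμ.subset inter_subset_right
  set S := hfin.toFinset with hS
  have hSG : ∀ x ∈ S, x ∈ G ∧ x ∈ msupp μ := fun x hx => by simpa [hS] using hx
  have hμG : μ.toMeasure G = ENNReal.ofReal (∑ x ∈ S, (μ.toMeasure.real {x} - 0)) := by
    have h1 : μ.toMeasure G = μ.toMeasure (S : Set X) := by
      refine le_antisymm ?_ (measure_mono fun x hx => (hSG x hx).1)
      calc μ.toMeasure G ≤ μ.toMeasure ((S : Set X) ∪ (msupp μ)ᶜ) := measure_mono fun x hx => by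
            by_cases h : x ∈ msupp μ <;> simp [hS, hx, h]
        _ ≤ _ := (measure_union_le _ _).trans (by rw [measure_compl_msupp, add_zero])
    rw [h1]
    simp only [sub_zero]
    rw [sum_measureReal_singleton, measureReal_def, ENNReal.ofReal_toReal (by simp)]
  have hlim : Tendsto (fun n => ENNReal.ofReal (∑ x ∈ S, (μ.toMeasure.real {x} - η n))) atTop
      (𝓝 (μ.toMeasure G)) := by
    rw [hμG]
    exact ENNReal.tendsto_ofReal (tendsto_finsetSum _ fun x _ => tendsto_const_nhds.sub hη)
  rw [← hlim.liminf_eq]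
  refine liminf_le_liminf ?_
  have hball : ∀ᶠ e in 𝓝 (0 : ℝ), ∀ x ∈ S, Metric.ball x e ⊆ G := by
    refine (eventually_all_finset S).2 fun x hx => ?_
    obtain ⟨d, hd, hdG⟩ := Metric.isOpen_iff.1 hG x (hSG x hx).1
    filter_upwards [Iio_mem_nhds hd] with e he
    exact (Metric.ball_subset_ball he.le).trans hdG
  have hdisj : ∀ᶠ e in 𝓝 (0 : ℝ), ∀ x ∈ S, ∀ y ∈ S, x ≠ y →
      Disjoint (Metric.ball x e) (Metric.ball y e) := by
    refine (eventually_all_finset S).2 fun x hx => (eventually_all_finset S).2 fun y hy => ?_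
    by_cases hxy : x = y
    · simp [hxy]
    filter_upwards [Iio_mem_nhds (half_pos (dist_pos.2 hxy))] with e he _
    exact Metric.ball_disjoint_ball (by simp only [mem_Iio] at he; linarith)
  filter_upwards [hη.eventually hball, hη.eventually hdisj] with n hb hd
  calc ENNReal.ofReal (∑ x ∈ S, (μ.toMeasure.real {x} - η n))
      ≤ ENNReal.ofReal (∑ x ∈ S, (ν n).toMeasure.real (Metric.ball x (η n))) :=
        ENNReal.ofReal_le_ofReal (Finset.sum_le_sum fun x hx => (hν n x (hSG x hx).2).le)
    _ = (ν n).toMeasure (⋃ x ∈ S, Metric.ball x (η n)) := by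
        rw [← measureReal_biUnion_finset (fun x hx y hy => hd x hx y hy)
          fun x _ => Metric.isOpen_ball.measurableSet, measureReal_def,
          ENNReal.ofReal_toReal (by simp)]
    _ ≤ (ν n).toMeasure G := measure_mono (iUnion₂_subset hb)

lemma exists_atomNhd_subset {μ : ProbabilityMeasure X} (hμ : (msupp μ).Finite)
    {U : Set (ProbabilityMeasure X)} (hU : U ∈ 𝓝 μ) : ∃ η > 0, atomNhd μ η ⊆ U := by
  by_contra! h
  choose ν hν hνU using fun n : ℕ => not_subset.1 (h (1 / ((n : ℝ) + 1)) Nat.one_div_pos_of_nat)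
  obtain ⟨n, hn⟩ :=
    ((tendsto_of_mem_atomNhd hμ tendsto_one_div_add_atTop_nhds_zero_nat hν).eventually hU).exists
  exact hνU n hn

/-- The finite measure `(1 - u) • (1 - s + s φ) ν + u • μ`. -/
noncomputable def dampedMix (φ : C(X, ℝ)) (μ ν : ProbabilityMeasure X) (s u : ℝ) :
    FiniteMeasure X :=
  ⟨(1 - u).toNNReal • ν.toMeasure.withDensity (fun x => ENNReal.ofReal (1 - s + s * φ x)) +
      u.toNNReal • μ.toMeasure,
    haveI : IsFiniteMeasure
        (ν.toMeasure.withDensity (fun x => ENNReal.ofReal (1 - s + s * φ x))) :=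
      isFiniteMeasure_withDensity_ofReal
        ((BoundedContinuousFunction.mkOfCompact
          (⟨fun x => 1 - s + s * φ x, by fun_prop⟩ : C(X, ℝ))).integrable _).2
    inferInstance⟩

lemma toMeasure_dampedMix (φ : C(X, ℝ)) (μ ν : ProbabilityMeasure X) (s u : ℝ) :
    (dampedMix φ μ ν s u : Measure X) =
      (1 - u).toNNReal • ν.toMeasure.withDensity (fun x => ENNReal.ofReal (1 - s + s * φ x)) +
      u.toNNReal • μ.toMeasure := rfl

lemma dampedMix_apply (φ : C(X, ℝ)) (μ ν : ProbabilityMeasure X) (s u : ℝ) (A : Set X) :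
    (dampedMix φ μ ν s u : Measure X) A =
      ENNReal.ofReal (1 - u) *
        ν.toMeasure.withDensity (fun x => ENNReal.ofReal (1 - s + s * φ x)) A +
      ENNReal.ofReal u * μ.toMeasure A := rfl

lemma integral_dampedMix {φ : C(X, ℝ)} (hφ : ∀ x, φ x ∈ Icc (0 : ℝ) 1)
    {μ ν : ProbabilityMeasure X} {s u : ℝ} (hs : s ∈ Icc (0 : ℝ) 1) (hu : u ∈ Icc (0 : ℝ) 1)
    (f : C(X, ℝ)) :
    ∫ x, f x ∂(dampedMix φ μ ν s u : Measure X) =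
      (1 - u) * ((1 - s) * ∫ x, f x ∂ν.toMeasure + s * ∫ x, (φ * f) x ∂ν.toMeasure)
        + u * ∫ x, f x ∂μ.toMeasure := by
  have int (g : C(X, ℝ)) (m : Measure X) [IsFiniteMeasure m] : Integrable g m :=
    (BoundedContinuousFunction.mkOfCompact g).integrable m
  have hw : Measurable fun x => ENNReal.ofReal (1 - s + s * φ x) := by fun_prop
  have : IsFiniteMeasure
      (ν.toMeasure.withDensity (fun x => ENNReal.ofReal (1 - s + s * φ x))) :=
    isFiniteMeasure_withDensity_ofReal
      (int (⟨fun x => 1 - s + s * φ x, by fun_prop⟩ : C(X, ℝ)) _).2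
  rw [toMeasure_dampedMix, integral_add_measure (int f _) (int f _),
    integral_smul_nnreal_measure, integral_smul_nnreal_measure,
    integral_withDensity_eq_integral_toReal_smul hw (by simp)]
  have h1 : ∀ x, (ENNReal.ofReal (1 - s + s * φ x)).toReal • f x =
      (1 - s) * f x + s * (φ * f) x := fun x => by
    rw [ENNReal.toReal_ofReal (by have := mul_nonneg hs.1 (hφ x).1; linarith [hs.2])]
    simp; ring
  simp_rw [h1]
  rw [integral_add ((int f _).const_mul _) ((int (φ * f) _).const_mul _),
    integral_const_mul, integral_const_mul]
  simp [NNReal.smul_def, Real.coe_toNNReal _ hu.1, hu.2, mul_add]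

lemma mass_dampedMix_le {φ : C(X, ℝ)} (hφ : ∀ x, φ x ∈ Icc (0 : ℝ) 1)
    {μ ν : ProbabilityMeasure X} {s u : ℝ} (hs : s ∈ Icc (0 : ℝ) 1) (hu : u ∈ Icc (0 : ℝ) 1) :
    (dampedMix φ μ ν s u : Measure X) univ ≤ 1 := by
  have h1 : ν.toMeasure.withDensity (fun x => ENNReal.ofReal (1 - s + s * φ x)) univ ≤ 1 := by
    rw [withDensity_apply _ MeasurableSet.univ]
    calc _ ≤ ∫⁻ x in univ, 1 ∂ν.toMeasure := lintegral_mono fun x => by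
          rw [← ENNReal.ofReal_one]
          refine ENNReal.ofReal_le_ofReal ?_
          nlinarith [mul_nonneg hs.1 (sub_nonneg.2 (hφ x).2)]
      _ = 1 := by simp
  rw [dampedMix_apply, measure_univ (μ := μ.toMeasure), mul_one]
  calc _ ≤ ENNReal.ofReal (1 - u) * 1 + ENNReal.ofReal u := by gcongr
    _ = 1 := by
      rw [mul_one, ← ENNReal.ofReal_add (by linarith [hu.2]) hu.1]
      simp

lemma dampedMix_real_eq {φ : C(X, ℝ)} {μ ν : ProbabilityMeasure X} {s u : ℝ}
    (hu : u ∈ Icc (0 : ℝ) 1) {B : Set X} (hB : MeasurableSet B) (hφB : ∀ x ∈ B, φ x = 1) :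
    (dampedMix φ μ ν s u : Measure X).real B =
      (1 - u) * ν.toMeasure.real B + u * μ.toMeasure.real B := by
  have h1 : ν.toMeasure.withDensity (fun x => ENNReal.ofReal (1 - s + s * φ x)) B =
      ν.toMeasure B := by
    rw [withDensity_apply _ hB, setLIntegral_congr_fun (g := fun _ => 1) hB fun x hx => by
      simp [hφB x hx]]
    simp
  rw [measureReal_def, dampedMix_apply, h1, ENNReal.toReal_add (by finiteness) (by finiteness)]
  simp [measureReal_def, hu.1, hu.2]

lemma dampedMix_null (φ : C(X, ℝ)) {μ ν : ProbabilityMeasure X} (s : ℝ) {u : ℝ} {A : Set X}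
    (hν : ν.toMeasure A = 0) (hμ : u = 0 ∨ μ.toMeasure A = 0) :
    (dampedMix φ μ ν s u : Measure X) A = 0 := by
  rw [dampedMix_apply, withDensity_absolutelyContinuous _ _ hν]
  rcases hμ with h | h <;> simp [h]

lemma dampedMix_one_null {φ : C(X, ℝ)} {μ : ProbabilityMeasure X} (ν : ProbabilityMeasure X)
    (u : ℝ) {A : Set X} (hA : MeasurableSet A) (hφ : ∀ x ∈ A, φ x = 0)
    (hμ : μ.toMeasure A = 0) : (dampedMix φ μ ν 1 u : Measure X) A = 0 := by
  rw [dampedMix_apply, hμ, withDensity_apply _ hA,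
    setLIntegral_congr_fun (g := fun _ => 0) hA fun x hx => by simp [hφ x hx]]
  simp

lemma dampedMix_zero_zero (φ : C(X, ℝ)) (μ ν : ProbabilityMeasure X) :
    dampedMix φ μ ν 0 0 = ν.toFiniteMeasure := by
  refine Subtype.ext (Measure.ext fun A _ => ?_)
  simpa using dampedMix_apply φ μ ν 0 0 A

lemma dampedMix_one_right (φ : C(X, ℝ)) (μ ν : ProbabilityMeasure X) (s : ℝ) :
    dampedMix φ μ ν s 1 = μ.toFiniteMeasure := by
  refine Subtype.ext (Measure.ext fun A _ => ?_)
  simpa using dampedMix_apply φ μ ν s 1 A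

lemma dampedMix_self {φ : C(X, ℝ)} {μ : ProbabilityMeasure X} (hφ : ∀ x ∈ msupp μ, φ x = 1)
    (s : ℝ) {u : ℝ} (hu : u ∈ Icc (0 : ℝ) 1) : dampedMix φ μ μ s u = μ.toFiniteMeasure := by
  refine Subtype.ext (Measure.ext fun A _ => (dampedMix_apply φ μ μ s u A).trans ?_)
  have h : (fun x => ENNReal.ofReal (1 - s + s * φ x)) =ᵐ[μ.toMeasure] 1 := by
    filter_upwards [mem_ae_iff.2 (measure_compl_msupp μ)] with x hx
    simp [hφ x hx]
  rw [withDensity_congr_ae h, withDensity_one, ← add_mul,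
    ← ENNReal.ofReal_add (sub_nonneg.2 hu.2) hu.1]
  simp

lemma continuous_dampedMix {Z : Type*} [TopologicalSpace Z] {φ : C(X, ℝ)}
    (hφ : ∀ x, φ x ∈ Icc (0 : ℝ) 1) (μ : ProbabilityMeasure X) {ν : Z → ProbabilityMeasure X}
    {s u : Z → ℝ} (hν : Continuous ν) (hs : Continuous s) (hu : Continuous u)
    (hs' : ∀ z, s z ∈ Icc (0 : ℝ) 1) (hu' : ∀ z, u z ∈ Icc (0 : ℝ) 1) :
    Continuous fun z => dampedMix φ μ (ν z) (s z) (u z) := by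
  refine FiniteMeasure.continuous_iff_forall_continuousMap_continuous_integral.2 fun f => ?_
  simp_rw [integral_dampedMix hφ (hs' _) (hu' _)]
  have h (g : C(X, ℝ)) : Continuous fun z => ∫ x, g x ∂(ν z).toMeasure :=
    (ProbabilityMeasure.continuous_integral_continuousMap g).comp hν
  have h1 := h f
  have h2 := h (φ * f)
  fun_prop

lemma normalize_dampedMix_mem_VRThickening [Nonempty X] {φ : C(X, ℝ)} {r δ : ℝ} (hδ : 0 ≤ δ)
    {μ ν : ProbabilityMeasure X} (hr : Metric.diam (msupp μ) + 2 * δ < r)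
    (hφ : ∀ x ∉ Metric.cthickening δ (msupp μ), φ x = 0) (hμ : (msupp μ).Finite)
    (hν : ν ∈ VRThickening X r) {s u : ℝ} (hsu : u = 0 ∨ s = 1) (h0 : dampedMix φ μ ν s u ≠ 0) :
    (dampedMix φ μ ν s u).normalize ∈ VRThickening X r := by
  have hfin : (msupp ν ∪ msupp μ).Finite := hν.1.union hμ
  refine ⟨hfin.subset (msupp_subset_of_isClosed hfin.isClosed (normalize_null h0
    (dampedMix_null φ s (measure_mono_null ?_ (measure_compl_msupp ν))
      (.inr (measure_mono_null ?_ (measure_compl_msupp μ)))))), ?_⟩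
  · exact compl_subset_compl.2 subset_union_left
  · exact compl_subset_compl.2 subset_union_right
  rcases hsu with rfl | rfl
  · refine (Metric.diam_mono ?_ hν.1.isBounded).trans_lt hν.2
    exact msupp_subset_of_isClosed hν.1.isClosed (normalize_null h0
      (dampedMix_null φ s (measure_compl_msupp ν) (.inl rfl)))
  · refine ((Metric.diam_mono ?_ Metric.isBounded_of_compactSpace).trans
      (Metric.diam_cthickening_le _ hδ)).trans_lt hr
    refine msupp_subset_of_isClosed Metric.isClosed_cthickening (normalize_null h0
      (dampedMix_one_null ν u Metric.isClosed_cthickening.measurableSet.compl hφ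
        (measure_mono_null ?_ (measure_compl_msupp μ))))
    exact compl_subset_compl.2 (Metric.self_subset_cthickening _)

lemma lt_dampedMix_ball {φ : C(X, ℝ)} {μ ν : ProbabilityMeasure X} {η : ℝ} (hη : 0 < η)
    (hφ : ∀ x ∈ Metric.cthickening η (msupp μ), φ x = 1) (hν : ν ∈ atomNhd μ η) (s : ℝ) {u : ℝ}
    (hu : u ∈ Icc (0 : ℝ) 1) {x : X} (hx : x ∈ msupp μ) :
    μ.toMeasure.real {x} - η < (dampedMix φ μ ν s u : Measure X).real (Metric.ball x η) := by
  rw [dampedMix_real_eq hu Metric.isOpen_ball.measurableSet fun y hy =>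
    hφ y (Metric.thickening_subset_cthickening _ _ (Metric.mem_thickening_iff.2 ⟨x, hx, hy⟩))]
  exact convex_Ioi (𝕜 := ℝ) (μ.toMeasure.real {x} - η) (mem_Ioi.2 (hν x hx))
    (mem_Ioi.2 (self_mem_atomNhd μ hη x hx)) (sub_nonneg.2 hu.2) hu.1 (by ring)

end

theorem stmt_13 {X : Type*} [MetricSpace X] [CompactSpace X] [MeasurableSpace X] [BorelSpace X]
    (r : ℝ) (hr : 0 < r)
    (μ : VRThickening X r) (U : Set (VRThickening X r)) (hU : U ∈ nhds μ) :
    ∃ V : Set (VRThickening X r), V ∈ nhds μ ∧ V ⊆ U ∧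
      ∃ (hμV : μ ∈ V) (H : unitInterval × V → V),
        Continuous H ∧
        (∀ ν : V, H (0, ν) = ν) ∧
        (∀ ν : V, H (1, ν) = ⟨μ, hμV⟩) ∧
        (∀ t : unitInterval, H (t, ⟨μ, hμV⟩) = ⟨μ, hμV⟩) := by
  obtain ⟨μ, hfin, hdiam⟩ := μ
  obtain ⟨x₀, hx₀, hpos⟩ := exists_measureReal_singleton_pos hfin
  have : Nonempty X := ⟨x₀⟩
  obtain ⟨δ, hδ, hδr⟩ : ∃ δ > 0, Metric.diam (msupp μ) + 2 * δ < r :=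
    ⟨(r - Metric.diam (msupp μ)) / 4, by linarith, by linarith⟩
  obtain ⟨φ, hφ0, hφ1, hφ⟩ := exists_continuous_zero_one_of_isClosed
    (Metric.isOpen_thickening (δ := δ) (E := msupp μ)).isClosed_compl
    (Metric.isClosed_cthickening (δ := δ / 2) (E := msupp μ))
    (disjoint_compl_left_iff_subset.2
      (Metric.cthickening_subset_thickening' hδ (half_lt_self hδ) _))
  obtain ⟨U', hU', hUU'⟩ := mem_nhds_subtype _ _ _ |>.1 hU
  obtain ⟨η₀, hη₀, hη₀U⟩ := exists_atomNhd_subset hfin hU'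
  set η := min η₀ (min (δ / 2) (μ.toMeasure.real {x₀}))
  have hη : 0 < η := lt_min hη₀ (lt_min (half_pos hδ) hpos)
  have hηδ : η ≤ δ / 2 := (min_le_right _ _).trans (min_le_left _ _)
  have hηx₀ : η ≤ μ.toMeasure.real {x₀} := (min_le_right _ _).trans (min_le_right _ _)
  have hφη : ∀ x ∈ Metric.cthickening η (msupp μ), φ x = 1 := fun x hx =>
    hφ1 (Metric.cthickening_mono hηδ _ hx)
  have hφδ : ∀ x ∉ Metric.cthickening δ (msupp μ), φ x = 0 := fun x hx =>
    hφ0 fun h => hx (Metric.thickening_subset_cthickening _ _ h)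
  let s : unitInterval → ℝ := fun t => min 1 (2 * t)
  let u : unitInterval → ℝ := fun t => max 0 (2 * t - 1)
  have hs (t) : s t ∈ Icc (0 : ℝ) 1 :=
    ⟨le_min zero_le_one (mul_nonneg zero_le_two t.2.1), min_le_left _ _⟩
  have hu (t) : u t ∈ Icc (0 : ℝ) 1 :=
    ⟨le_max_left _ _, max_le zero_le_one (by linarith [t.2.2])⟩
  have hsu (t) : u t = 0 ∨ s t = 1 := by
    rcases le_total (2 * (t : ℝ)) 1 with h | h
    · exact .inl (max_eq_left (by linarith))
    · exact .inr (min_eq_left h)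
  let D : unitInterval → ProbabilityMeasure X → FiniteMeasure X := fun t ν =>
    dampedMix φ μ ν (s t) (u t)
  have hD0 (t) {ν} (hν : ν ∈ atomNhd μ η) : D t ν ≠ 0 := fun h => by
    have h1 := lt_dampedMix_ball hη hφη hν (s t) (hu t) hx₀
    rw [show dampedMix φ μ ν (s t) (u t) = 0 from h] at h1
    simp only [FiniteMeasure.toMeasure_zero, measureReal_zero_apply] at h1
    linarith
  have hDmem (t) {ν} (hν : ν ∈ atomNhd μ η) : (D t ν).normalize ∈ atomNhd μ η := fun x hx =>
    (lt_dampedMix_ball hη hφη hν (s t) (hu t) hx).trans_le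
      (measureReal_le_normalize (mass_dampedMix_le hφ (hs t) (hu t)) _)
  refine ⟨Subtype.val ⁻¹' atomNhd μ η,
    continuous_subtype_val.continuousAt.preimage_mem_nhds (atomNhd_mem_nhds hfin hη),
    (preimage_mono ((atomNhd_mono μ (min_le_left _ _)).trans hη₀U)).trans hUU',
    self_mem_atomNhd μ hη,
    fun p => ⟨⟨(D p.1 p.2.1.1).normalize, normalize_dampedMix_mem_VRThickening hδ.le hδr hφδ hfin
      p.2.1.2 (hsu p.1) (hD0 p.1 p.2.2)⟩, hDmem p.1 p.2.2⟩, ?_, ?_, ?_, ?_⟩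
  · refine .subtype_mk (.subtype_mk (continuous_iff_continuousAt.2 fun p => ?_) _) _
    refine FiniteMeasure.tendsto_normalize_of_tendsto (Continuous.tendsto ?_ p) (hD0 p.1 p.2.2)
    exact continuous_dampedMix hφ μ (by fun_prop) (by fun_prop) (by fun_prop)
      (fun p => hs p.1) fun p => hu p.1
  · intro ν
    ext1; ext1
    simp [D, s, u, dampedMix_zero_zero]
  · intro ν
    ext1; ext1
    have : u 1 = 1 := by norm_num [u]
    simp [D, this, dampedMix_one_right]
  · intro t
    ext1; ext1
    simp [D, dampedMix_self (fun x hx => hφη x (Metric.self_subset_cthickening _ hx)) (s t) (hu t)]
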